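/- Suppose that whenever Ω* ∩ argmin_{x∈A} F(x,λ*,c) ≠ ∅ and min_{x∈A} F(x,λ*,c) = f* for some λ* ∈ Λ and c > 0, the function F is strictly globally parametrically exact with λ* a strictly exact tuning parameter. Suppose also that A and Ω are closed, f is lower semicontinuous on Ω, and F(·,λ,c) is lower semicontinuous on A for all λ ∈ Λ and c > 0. Then F is strictly globally parametrically exact if and only if there exist λ* ∈ Λ and c₀ > 0 such that: (1) F is of penalty-type for λ = λ*; (2) there exists a bounded set K with {x ∈ A : F(x,λ*,c) < f*} ⊆ K for all c ≥ c₀; (3) F is locally parametrically exact with exact tuning parameter λ* at every globally optimal solution of (P); and (4) F(x*,λ*,c) = f* for all x* ∈ Ω* and all c ≥ c₀. -/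

import Mathlib

open Set Filter Topology

/-- The set of global minimizers of `g` on the set `A`. -/
def minimizersOn {X : Type*} (g : X → EReal) (A : Set X) : Set X :=
  {x ∈ A | ∀ y ∈ A, g x ≤ g y}

/-- The set of globally optimal solutions of the problem (P):
minimize `f x` subject to `x ∈ M`, `x ∈ A`. -/
def optSet {X : Type*} (f : X → EReal) (M A : Set X) : Set X :=
  minimizersOn f (M ∩ A)

/-- `F` is globally parametrically exact with exact tuning parameter `lam`. -/
def GloballyParamExact {X Λ : Type*} (f : X → EReal) (M A : Set X)
    (F : X → Λ → ℝ → EReal) (lam : Λ) : Prop :=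
  ∃ cs > (0 : ℝ), ∀ c ≥ cs, minimizersOn (fun x => F x lam c) A = optSet f M A

/-- `F` is locally parametrically exact at `x₀` with exact tuning parameter `lam`. -/
def LocallyParamExact {X Λ : Type*} [TopologicalSpace X] (A : Set X)
    (F : X → Λ → ℝ → EReal) (lam : Λ) (x₀ : X) : Prop :=
  ∃ cs > (0 : ℝ), ∃ U ∈ 𝓝 x₀, ∀ c ≥ cs, ∀ x ∈ U ∩ A, F x₀ lam c ≤ F x lam c

/-- `F` is a penalty-type separating function for `λ = lam`. -/
def PenaltyType {X Λ : Type*} [TopologicalSpace X] (f : X → EReal) (M A : Set X)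
    (F : X → Λ → ℝ → EReal) (lam : Λ) : Prop :=
  ∃ c₀ > (0 : ℝ), ∀ cseq : ℕ → ℝ, StrictMono cseq → (∀ n, c₀ ≤ cseq n) →
    Tendsto cseq atTop atTop →
    ∀ xseq : ℕ → X, (∀ n, xseq n ∈ minimizersOn (fun x => F x lam (cseq n)) A) →
    ∀ x₀ : X, MapClusterPt x₀ atTop xseq → x₀ ∈ optSet f M A

/-- `F` is non-degenerate for `λ = lam`. -/
def NonDegenerate {X Λ : Type*} [NormedAddCommGroup X] (A : Set X)
    (F : X → Λ → ℝ → EReal) (lam : Λ) : Prop :=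
  ∃ c₀ > (0 : ℝ), ∃ R > (0 : ℝ), ∀ c ≥ c₀,
    ∃ x ∈ minimizersOn (fun y => F y lam c) A, ‖x‖ ≤ R

/-- `F` is strictly globally parametrically exact with strictly exact tuning
parameter `lam`. -/
def StrictGloballyParamExact {X Λ : Type*} (f : X → EReal) (M A : Set X)
    (F : X → Λ → ℝ → EReal) (lam : Λ) : Prop :=
  GloballyParamExact f M A F lam ∧
  ∃ c₀ > (0 : ℝ), ∀ c ≥ c₀,
    sInf ((fun x => F x lam c) '' A) = sInf (f '' (M ∩ A))

theorem sInf_image_eq_of_mem_minimizersOn {X : Type*} {g : X → EReal} {A : Set X} {x : X}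
    (hx : x ∈ minimizersOn g A) : sInf (g '' A) = g x :=
  IsLeast.csInf_eq ⟨mem_image_of_mem g hx.1, forall_mem_image.2 hx.2⟩

theorem isClosed_minimizersOn {X : Type*} [TopologicalSpace X] {g : X → EReal} {A : Set X}
    (hA : IsClosed A) (hg : LowerSemicontinuousOn g A) : IsClosed (minimizersOn g A) := by
  refine isClosed_of_closure_subset fun x hx => ?_
  have hxA : x ∈ A := hA.closure_subset_iff.2 (fun y hy => hy.1) hx
  refine ⟨hxA, fun y hy => ?_⟩
  by_contra! h
  obtain ⟨U, hU, hxU⟩ := mem_nhdsWithin_iff_exists_mem_nhds_inter.1 (hg x hxA (g y) h)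
  obtain ⟨z, hzU, hz⟩ := mem_closure_iff_nhds.1 hx U hU
  exact (hxU ⟨hzU, hz.1⟩).not_ge (hz.2 y hy)

/-- A lower semicontinuous function with a nonempty sublevel set contained in a compact set
attains its minimum. -/
theorem exists_mem_minimizersOn_of_sublevel_subset {X : Type*} [TopologicalSpace X]
    {g : X → EReal} {A K : Set X} {a : EReal} (hA : IsClosed A) (hg : LowerSemicontinuousOn g A)
    (hK : IsCompact K) (hsub : {x ∈ A | g x < a} ⊆ K) (hne : ∃ x ∈ A, g x < a) :
    ∃ x ∈ minimizersOn g A, x ∈ K ∧ g x < a := by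
  obtain ⟨z, hzA, hz⟩ := hne
  obtain ⟨x, hx, hmin⟩ := LowerSemicontinuousOn.exists_isMinOn
    (⟨z, hsub ⟨hzA, hz⟩, hzA⟩ : (K ∩ A).Nonempty) (hK.inter_right hA)
    (hg.mono inter_subset_right)
  have hxa : g x < a := (hmin ⟨hsub ⟨hzA, hz⟩, hzA⟩).trans_lt hz
  refine ⟨x, ⟨hx.2, fun y hy => ?_⟩, hx.1, hxa⟩
  by_cases hya : g y < a
  · exact hmin ⟨hsub ⟨hy, hya⟩, hy⟩
  · exact hxa.le.trans (not_lt.1 hya)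

/-- Strengthened Localization Principle in the Parametric Form II. -/
theorem strengthened_localization_principle_parametric_II
    {X : Type*} [NormedAddCommGroup X] [NormedSpace ℝ X] [FiniteDimensional ℝ X]
    {Λ : Type*} [Nonempty Λ]
    (f : X → EReal) (M A : Set X) (F : X → Λ → ℝ → EReal)
    (hM : M.Nonempty) (hA : A.Nonempty)
    (hfeas : ∃ x ∈ M ∩ A, f x < ⊤)
    (hopt : (optSet f M A).Nonempty)
    (hkey : ∀ lam : Λ, ∀ c > (0 : ℝ),
      (optSet f M A ∩ minimizersOn (fun x => F x lam c) A).Nonempty →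
      sInf ((fun x => F x lam c) '' A) = sInf (f '' (M ∩ A)) →
      StrictGloballyParamExact f M A F lam)
    (hAcl : IsClosed A) (hΩ : IsClosed (M ∩ A))
    (hf : LowerSemicontinuousOn f (M ∩ A))
    (hF : ∀ (lam : Λ) (c : ℝ), 0 < c →
      LowerSemicontinuousOn (fun x => F x lam c) A) :
    (∃ lam : Λ, StrictGloballyParamExact f M A F lam) ↔
      ∃ lam : Λ, ∃ c₀ > (0 : ℝ),
        PenaltyType f M A F lam ∧
        (∃ K : Set X, Bornology.IsBounded K ∧
          ∀ c ≥ c₀, {x ∈ A | F x lam c < sInf (f '' (M ∩ A))} ⊆ K) ∧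
        (∀ x₀ ∈ optSet f M A, LocallyParamExact A F lam x₀) ∧
        (∀ xs ∈ optSet f M A, ∀ c ≥ c₀, F xs lam c = sInf (f '' (M ∩ A))) := by
  have := FiniteDimensional.proper ℝ X
  constructor
  · rintro ⟨lam, ⟨cs, hcs, hex⟩, c₁, hc₁, hinf⟩
    have hval : ∀ c ≥ max cs c₁, ∀ x ∈ optSet f M A, F x lam c = sInf (f '' (M ∩ A)) := by
      intro c hc x hx
      rw [← hinf c ((le_max_right _ _).trans hc)]
      rw [← hex c ((le_max_left _ _).trans hc)] at hx
      exact (sInf_image_eq_of_mem_minimizersOn hx).symm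
    refine ⟨lam, max cs c₁, lt_max_of_lt_left hcs, ?_, ⟨∅, Bornology.isBounded_empty, ?_⟩, ?_,
      fun x hx c hc => hval c hc x hx⟩
    · refine ⟨cs, hcs, fun cseq _ hle _ xseq hx x₀ hx₀ => ?_⟩
      refine (isClosed_minimizersOn hΩ hf).mem_of_mapClusterPt hx₀ (Eventually.of_forall fun n => ?_)
      have := hx n
      rwa [hex _ (hle n)] at this
    · rintro c hc x ⟨hxA, hx⟩
      rw [← hinf c ((le_max_right _ _).trans hc)] at hx
      exact hx.not_ge (sInf_le (mem_image_of_mem _ hxA))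
    · intro x₀ hx₀
      refine ⟨cs, hcs, univ, univ_mem, fun c hc x hx => ?_⟩
      rw [← hex c hc] at hx₀
      exact hx₀.2 x hx.2
  · rintro ⟨lam, c₀, hc₀, ⟨c₁, -, hpen⟩, ⟨K, hK, hsub⟩, hloc, hval⟩
    refine ⟨lam, ?_⟩
    by_cases hlow : ∃ c ≥ c₀, ∀ x ∈ A, sInf (f '' (M ∩ A)) ≤ F x lam c
    · obtain ⟨c, hc, hle⟩ := hlow
      obtain ⟨xs, hxs⟩ := hopt
      have hmin : xs ∈ minimizersOn (fun x => F x lam c) A :=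
        ⟨hxs.1.2, fun y hy => (hval xs hxs c hc).trans_le (hle y hy)⟩
      exact hkey lam c (hc₀.trans_le hc) ⟨xs, hxs, hmin⟩
        ((sInf_image_eq_of_mem_minimizersOn hmin).trans (hval xs hxs c hc))
    · exfalso
      push Not at hlow
      let cseq : ℕ → ℝ := fun n => max c₀ c₁ + n
      have hle : ∀ n, max c₀ c₁ ≤ cseq n := fun n => le_add_of_nonneg_right n.cast_nonneg
      have hle₀ : ∀ n, c₀ ≤ cseq n := fun n => (le_max_left _ _).trans (hle n)
      have htend : Tendsto cseq atTop atTop :=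
        tendsto_atTop_add_const_left _ _ tendsto_natCast_atTop_atTop
      choose xseq hmin hxK hlt using fun n => exists_mem_minimizersOn_of_sublevel_subset hAcl
        (hF lam (cseq n) (hc₀.trans_le (hle₀ n))) hK.isCompact_closure
        ((hsub _ (hle₀ n)).trans subset_closure) (hlow _ (hle₀ n))
      obtain ⟨x₀, -, hx₀⟩ := hK.isCompact_closure.exists_mapClusterPt (f := atTop) (u := xseq)
        (tendsto_principal.2 (Eventually.of_forall hxK))
      have hx₀opt : x₀ ∈ optSet f M A :=
        hpen cseq (fun m n h => add_lt_add_right (Nat.cast_lt.2 h) _)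
          (fun n => (le_max_right _ _).trans (hle n)) htend xseq hmin x₀ hx₀
      obtain ⟨cs, -, U, hU, hmin₀⟩ := hloc x₀ hx₀opt
      obtain ⟨n, hnU, hn⟩ :=
        ((hx₀.frequently hU).and_eventually (htend.eventually_ge_atTop cs)).exists
      have h := hmin₀ _ hn _ ⟨hnU, (hmin n).1⟩
      rw [hval x₀ hx₀opt _ (hle₀ n)] at h
      exact (hlt n).not_ge h
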